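/- For n = 2ν even with 2ν - 1 ≥ k ≥ ν - 1 ≥ 1, the determinant of the n×n payoff matrix A(2ν, k, x) equals F_{2ν-k-1}(x)², where F_a is defined by F_0 = 1, F_1 = x, F_{a+2}(x) = (x+1)F_{a+1}(x) - F_a(x). Consequently, A(2ν,k) = A(2ν,k,0) is singular if and only if k ≡ 2ν + 1 (mod 3). -/

import Mathlib

open Polynomial

/-- The `n × n` skew-symmetric Toeplitz payoff matrix `A(n,k,x)` over `ℝ`. -/
def A (n k : ℕ) (x : ℝ) : Matrix (Fin n) (Fin n) ℝ :=
  fun r s =>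
    if (r : ℕ) < (s : ℕ) then (if (s : ℕ) - (r : ℕ) ≤ k then 1 else -x)
    else if (s : ℕ) < (r : ℕ) then (if (r : ℕ) - (s : ℕ) ≤ k then -1 else x)
    else 0

/-- The polynomial sequence `F_a` with `F_0 = 1`, `F_1 = x`,
`F_{a+2} = (x+1) F_{a+1} - F_a`. -/
noncomputable def F : ℕ → Polynomial ℝ
  | 0 => 1
  | 1 => X
  | (a + 2) => (X + 1) * F (a + 1) - F a


/-- tridiagonal matrix with corner `y-1` -/
def Tri (m : ℕ) (y : ℝ) : Matrix (Fin m) (Fin m) ℝ := fun i j =>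
  if (i : ℕ) = j then (if (i : ℕ) + 1 = m then y - 1 else y)
  else if (i : ℕ) + 1 = j ∨ (j : ℕ) + 1 = i then -1 else 0

theorem Tri_succ (m : ℕ) (y : ℝ) (i j : Fin m) : Tri (m+1) y i.succ j.succ = Tri m y i j := by
  simp only [Tri, Fin.val_succ]
  congr 1 <;> simp

theorem Tri_rec (m : ℕ) (y : ℝ) :
    (Tri (m+2) y).det = y * (Tri (m+1) y).det - (Tri m y).det := by
  rw [Matrix.det_succ_row_zero, Fin.sum_univ_succ, Fin.sum_univ_succ]
  have h0 : ∀ i : Fin m, Tri (m+2) y 0 i.succ.succ = 0 := by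
    intro i
    simp [Tri]
  have h1 : (Tri (m+2) y).submatrix Fin.succ (Fin.succAbove 0) = Tri (m+1) y := by
    ext i j
    simp [Tri_succ]
  have h2 : ((Tri (m+2) y).submatrix Fin.succ (Fin.succAbove (Fin.succ 0))).det
      = - (Tri m y).det := by
    rw [Matrix.det_succ_column_zero, Fin.sum_univ_succ]
    have h3 : ((Tri (m+2) y).submatrix Fin.succ (Fin.succAbove (Fin.succ 0))).submatrix
        (Fin.succAbove 0) Fin.succ = Tri m y := by
      ext i j
      have : (Fin.succAbove (Fin.succ (0 : Fin (m+1))) j.succ) = j.succ.succ := by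
        rw [Fin.succ_succAbove_succ]; simp
      simp only [Matrix.submatrix_apply, this]
      simp [Tri_succ]
    rw [h3]
    have h4 : ∀ i : Fin m, (Tri (m+2) y) i.succ.succ 0 = 0 := by
      intro i
      simp [Tri]
    simp [h4]
    simp [Tri]
  rw [h1, h2]
  simp [h0]
  simp [Tri]
  ring

theorem Tri_det (x : ℝ) : ∀ m : ℕ, (Tri m (x+1)).det = (F m).eval x
  | 0 => by simp [F]
  | 1 => by simp [F, Tri]
  | (m+2) => by
    rw [Tri_rec, Tri_det x (m+1), Tri_det x m]
    simp [F]

/-- the zigzag -/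
def zig (m : ℕ) (t : Fin m) : Fin m :=
  ⟨if (t : ℕ) % 2 = 0 then t / 2 else m - 1 - t / 2, by have := t.2; split <;> omega⟩

theorem zig_bij (m : ℕ) : Function.Bijective (zig m) := by
  rw [Fintype.bijective_iff_injective_and_card]
  refine ⟨?_, rfl⟩
  intro a b h
  have ha := a.2
  have hb := b.2
  simp only [zig, Fin.mk.injEq] at h
  ext
  split_ifs at h <;> omega

/-- `I + N - y R` -/
def G (n m : ℕ) (y : ℝ) : Matrix (Fin n) (Fin n) ℝ := fun i j =>
  (if (i : ℕ) = j ∨ (i : ℕ) + 1 = j then 1 else 0) - (if (i : ℕ) + j + 1 = m then y else 0)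

theorem G_det (m : ℕ) (x : ℝ) : (G m m (x+1)).det ^ 2 = (F m).eval x ^ 2 := by
  let e := Equiv.ofBijective (zig m) (zig_bij m)
  have h : (G m m (x+1)).submatrix (e.trans Fin.revPerm) e = - Tri m (x+1) := by
    ext i j
    have hi := i.2
    have hj := j.2
    simp only [Matrix.submatrix_apply, Matrix.neg_apply, G, Tri, Equiv.trans_apply,
      Fin.revPerm_apply, Fin.val_rev, e, Equiv.ofBijective_apply, zig]
    by_cases h1 : (i : ℕ) = j
    · rw [if_pos h1]
      by_cases h2 : (i : ℕ) + 1 = m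
      · rw [if_pos h2, if_pos, if_pos]
        · ring
        · split_ifs <;> omega
        · split_ifs <;> omega
      · rw [if_neg h2, if_neg, if_pos]
        · ring
        · split_ifs <;> omega
        · split_ifs <;> omega
    · rw [if_neg h1]
      by_cases h2 : (i : ℕ) + 1 = j ∨ (j : ℕ) + 1 = i
      · rw [if_pos h2, if_pos, if_neg]
        · ring
        · split_ifs <;> omega
        · split_ifs <;> omega
      · rw [if_neg h2, if_neg, if_neg]
        · ring
        · split_ifs <;> omega
        · split_ifs <;> omega
  have h2 := Matrix.abs_det_submatrix_equiv_equiv (e.trans Fin.revPerm) e (G m m (x+1))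
  rw [h, Matrix.det_neg, Tri_det] at h2
  rw [← sq_abs, ← h2, sq_abs, mul_pow, ← pow_mul, mul_comm _ 2, pow_mul]
  simp

theorem G_red (m p : ℕ) (y : ℝ) : (G (m+p) m y).det = (G m m y).det := by
  rw [← Matrix.det_submatrix_equiv_self finSumFinEquiv]
  have : (G (m+p) m y).submatrix finSumFinEquiv finSumFinEquiv =
    Matrix.fromBlocks (G m m y) ((G (m+p) m y).submatrix (Fin.castAdd p) (Fin.natAdd m)) 0
      (G p 0 y) := by
    ext i j
    have hG : ∀ (n m : ℕ) (a b : Fin n), G n m y a b =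
      (if (a : ℕ) = b ∨ (a : ℕ) + 1 = b then 1 else 0)
        - (if (a : ℕ) + b + 1 = m then y else 0) := fun _ _ _ _ => rfl
    rcases i with i | i <;> rcases j with j | j <;> have hi := i.2 <;> have hj := j.2 <;>
      rw [Matrix.submatrix_apply]
    · rw [finSumFinEquiv_apply_left, finSumFinEquiv_apply_left, Matrix.fromBlocks_apply₁₁, hG, hG]
      rfl
    · simp
    · rw [finSumFinEquiv_apply_left, finSumFinEquiv_apply_right, Matrix.fromBlocks_apply₂₁, hG,
        Matrix.zero_apply, Fin.val_castAdd, Fin.val_natAdd]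
      split_ifs <;> first | omega | simp
    · rw [finSumFinEquiv_apply_right, finSumFinEquiv_apply_right, Matrix.fromBlocks_apply₂₂, hG,
        hG, Fin.val_natAdd, Fin.val_natAdd]
      split_ifs <;> first | contradiction | omega | simp
  rw [this, Matrix.det_fromBlocks_zero₂₁, Matrix.det_of_isUpperTriangular (M := G p 0 y)]
  · simp [G]
  · intro i j hij
    have : (j : ℕ) < i := hij
    simp only [G]
    rw [if_neg (by omega), if_neg (by omega)]
    simp

/-- `S` -/
def SS (n : ℕ) : Matrix (Fin n) (Fin n) ℝ := fun i j =>
  if (i : ℕ) < j then 1 else if (j : ℕ) < i then -1 else 0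

/-- `C` -/
def CMat (n m : ℕ) (x : ℝ) : Matrix (Fin n) (Fin n) ℝ := fun i j =>
  if m ≤ (i : ℕ) + j then 1 else -x

/-- difference matrix -/
def DD (n : ℕ) : Matrix (Fin n) (Fin n) ℝ := fun i j =>
  (if i = j then 1 else 0) - (if (i : ℕ) + 1 = j then 1 else 0)

theorem DD_det (n : ℕ) : (DD n).det = 1 := by
  rw [Matrix.det_of_isUpperTriangular]
  · simp [DD]
  · intro i j hij
    have : (j : ℕ) < i := hij
    simp only [DD, Fin.ext_iff]
    rw [if_neg (by omega), if_neg (by omega)]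
    simp

theorem DD_mul (n m : ℕ) (hm : m ≤ n) (x : ℝ) : DD n * (SS n + CMat n m x) = G n m (x+1) := by
  ext i j
  have hi := i.2
  have hj := j.2
  have key : (DD n * (SS n + CMat n m x)) i j = (SS n + CMat n m x) i j -
      (if h : (i : ℕ) + 1 < n then (SS n + CMat n m x) ⟨i + 1, h⟩ j else 0) := by
    rw [Matrix.mul_apply]
    simp only [DD, sub_mul, Finset.sum_sub_distrib, ite_mul, one_mul, zero_mul]
    congr 1
    · simp
    · split_ifs with h
      · rw [Finset.sum_eq_single ⟨i + 1, h⟩]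
        · simp
        · intro b _ hb
          rw [if_neg]
          intro hc
          exact hb (Fin.ext hc.symm)
        · simp
      · apply Finset.sum_eq_zero
        intro b _
        have := b.2
        rw [if_neg (by omega)]
  rw [key]
  simp only [Matrix.add_apply, SS, CMat, G]
  split_ifs <;> first | omega | ring

theorem SC_det (n m : ℕ) (hm : m ≤ n) (x : ℝ) :
    (SS n + CMat n m x).det ^ 2 = (F m).eval x ^ 2 := by
  have h := congrArg Matrix.det (DD_mul n m hm x)
  rw [Matrix.det_mul, DD_det, one_mul] at h
  obtain ⟨p, rfl⟩ := Nat.exists_eq_add_of_le hm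
  rw [h, G_red, G_det]

theorem block_det {n : ℕ} (S C : Matrix (Fin n) (Fin n) ℝ) :
    (Matrix.fromBlocks S C (-C) (-S)).det = (S + C).det * (C - S).det := by
  have h : Matrix.fromBlocks 1 0 1 1 * Matrix.fromBlocks S C (-C) (-S) *
      Matrix.fromBlocks 1 0 1 1 = Matrix.fromBlocks (S + C) C 0 (C - S) := by
    simp only [Matrix.fromBlocks_multiply]
    congr 1 <;> simp <;> abel
  have h2 := congrArg Matrix.det h
  simpa [Matrix.det_mul, Matrix.det_fromBlocks_zero₂₁, Matrix.det_fromBlocks_zero₁₂] using h2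

/-- fold -/
def fold (n : ℕ) : Fin n ⊕ Fin n → Fin (2 * n)
  | Sum.inl i => ⟨i, by have := i.2; omega⟩
  | Sum.inr i => ⟨2 * n - 1 - i, by have := i.2; omega⟩

theorem fold_bij (n : ℕ) : Function.Bijective (fold n) := by
  rw [Fintype.bijective_iff_injective_and_card]
  refine ⟨?_, by simp; omega⟩
  rintro (a | a) (b | b) h <;> have ha := a.2 <;> have hb := b.2 <;>
    simp only [fold, Fin.mk.injEq] at h
  · congr 1; ext; omega
  · omega
  · omega
  · congr 1; ext; omega

theorem A_det (n k : ℕ) (h1 : n - 1 ≤ k) (h2 : k ≤ 2 * n - 1) (hn : 2 ≤ n) (x : ℝ) :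
    (A (2 * n) k x).det = (F (2 * n - k - 1)).eval x ^ 2 := by
  let e := Equiv.ofBijective (fold n) (fold_bij n)
  have h : (A (2 * n) k x).submatrix e e = Matrix.fromBlocks (SS n) (CMat n (2 * n - k - 1) x)
      (-(CMat n (2 * n - k - 1) x)) (-(SS n)) := by
    ext i j
    rcases i with i | i <;> rcases j with j | j <;> have hi := i.2 <;> have hj := j.2 <;>
      simp only [Matrix.submatrix_apply, e, Equiv.ofBijective_apply, fold, A, SS, CMat,
        Matrix.fromBlocks_apply₁₁, Matrix.fromBlocks_apply₁₂, Matrix.fromBlocks_apply₂₁,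
        Matrix.fromBlocks_apply₂₂, Matrix.neg_apply] <;>
      split_ifs <;> first | omega | simp
  rw [← Matrix.det_submatrix_equiv_self e, h, block_det]
  have ht : CMat n (2 * n - k - 1) x - SS n = (SS n + CMat n (2 * n - k - 1) x).transpose := by
    ext i j
    simp only [Matrix.sub_apply, Matrix.transpose_apply, Matrix.add_apply, SS, CMat]
    rw [add_comm (j : ℕ) i]
    split_ifs <;> first | omega | ring
  rw [ht, Matrix.det_transpose, ← sq, SC_det _ _ (by omega)]

theorem F_zero (a : ℕ) : (F (3*a)).eval 0 = (-1)^a ∧ (F (3*a+1)).eval 0 = 0 ∧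
    (F (3*a+2)).eval 0 = (-1)^(a+1) := by
  induction a with
  | zero => simp [F]
  | succ a ih =>
    obtain ⟨h0, h1, h2⟩ := ih
    have r : ∀ b, (F (b+2)).eval 0 = (F (b+1)).eval 0 - (F b).eval 0 := by
      intro b; simp [F]
    have h3 : (F (3*a+3)).eval 0 = (-1)^(a+1) := by rw [r, h2, h1]; ring
    have h4 : (F (3*a+4)).eval 0 = 0 := by rw [r, h3, h2]; ring
    have h5 : (F (3*a+5)).eval 0 = (-1)^(a+2) := by rw [r, h4, h3]; ring
    exact ⟨h3, h4, h5⟩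

theorem F_zero_iff (m : ℕ) : (F m).eval 0 = 0 ↔ m % 3 = 1 := by
  obtain ⟨h0, h1, h2⟩ := F_zero (m / 3)
  have : m % 3 = 0 ∨ m % 3 = 1 ∨ m % 3 = 2 := by omega
  rcases this with h | h | h
  · rw [show 3 * (m / 3) = m by omega] at h0
    simp [h0, h]
  · rw [show 3 * (m / 3) + 1 = m by omega] at h1
    simp [h1, h]
  · rw [show 3 * (m / 3) + 2 = m by omega] at h2
    simp [h2, h]

theorem stmt_18 (ν k : ℕ) (hν : 2 ≤ ν) (hk1 : ν - 1 ≤ k) (hk2 : k ≤ 2 * ν - 1) :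
    (∀ x : ℝ, (A (2 * ν) k x).det = (F (2 * ν - k - 1)).eval x ^ 2) ∧
    ((A (2 * ν) k 0).det = 0 ↔ k % 3 = (2 * ν + 1) % 3) := by
  refine ⟨A_det ν k hk1 hk2 hν, ?_⟩
  rw [A_det ν k hk1 hk2 hν, sq_eq_zero_iff, F_zero_iff]
  omega
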